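/- Let G be a finite group, π a set of primes, p a prime in π dividing |G|, and P a Sylow p-subgroup of G. Then d_π(G) ≤ d(P), where d(P) = k(P)/|P| is the commuting probability of P. -/

import Mathlib

open scoped Classical Pointwise

/-- A `π`-element: every prime divisor of its order lies in `π`. -/
def IsPiElement {G : Type*} [Group G] (π : Set ℕ) (x : G) : Prop :=
  ∀ q : ℕ, q.Prime → q ∣ orderOf x → q ∈ π

/-- `kPi π G` is the number of conjugacy classes of `π`-elements of `G`. -/
noncomputable def kPi (π : Set ℕ) (G : Type*) [Group G] : ℕ :=
  Nat.card {c : ConjClasses G | ∃ x : G, ConjClasses.mk x = c ∧ IsPiElement π x}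

/-- The `π`-part of a natural number: the largest divisor all of whose prime
divisors lie in `π`. -/
noncomputable def piPart (π : Set ℕ) (n : ℕ) : ℕ :=
  n.factorization.prod fun p k => if p ∈ π then p ^ k else 1

/-- `dPi π G = kPi π G / |G|_π`. -/
noncomputable def dPi (π : Set ℕ) (G : Type*) [Group G] : ℚ :=
  (kPi π G : ℚ) / (piPart π (Nat.card G) : ℚ)

theorem pi_decomp {G : Type*} [Group G] [Finite G] (p : ℕ) (hp : p.Prime) (g : G) :
    ∃ x y : G, g = x * y ∧ Commute x y ∧ (∃ a, x ^ (p ^ a) = 1) ∧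
      orderOf y ∣ orderOf g ∧ ¬ p ∣ orderOf y := by
  have hn : orderOf g ≠ 0 := (orderOf_pos g).ne'
  obtain ⟨a, m, hm, hnm⟩ := Nat.exists_eq_pow_mul_and_not_dvd hn p hp.ne_one
  have hc : IsCoprime ((p ^ a : ℕ) : ℤ) (m : ℤ) :=
    Nat.isCoprime_iff_coprime.2 (Nat.Coprime.pow_left a ((Nat.Prime.coprime_iff_not_dvd hp).2 hm))
  obtain ⟨v, u, huv⟩ := hc
  have h1 : g ^ ((p ^ a : ℕ) * m : ℤ) = 1 := by
    have := pow_orderOf_eq_one g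
    rw [hnm] at this
    exact_mod_cast this
  have hy : orderOf (g ^ (v * (p ^ a : ℕ) : ℤ)) ∣ m := by
    apply orderOf_dvd_of_pow_eq_one
    rw [← zpow_natCast, ← zpow_mul, mul_assoc, mul_comm, zpow_mul, h1, one_zpow]
  refine ⟨g ^ (u * m : ℤ), g ^ (v * (p ^ a : ℕ) : ℤ), ?_, ?_, ⟨a, ?_⟩, ?_, ?_⟩
  · rw [← zpow_add, add_comm, huv, zpow_one]
  · exact ((Commute.refl g).zpow_left _).zpow_right _
  · rw [← zpow_natCast, ← zpow_mul, mul_assoc, mul_comm, mul_comm (m : ℤ), zpow_mul, h1, one_zpow]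
  · exact hy.trans (hnm ▸ Dvd.intro_left _ rfl)
  · exact fun h => hm (h.trans hy)

theorem kPi_mono {G : Type*} [Group G] [Finite G] (π σ : Set ℕ)
    (h : ∀ x : G, IsPiElement π x → IsPiElement σ x) : kPi π G ≤ kPi σ G := by
  unfold kPi
  apply Nat.card_mono (Set.toFinite _)
  rintro c ⟨x, hx, hx'⟩
  exact ⟨x, hx, h x hx'⟩

theorem prod_mono_dvd (t : Finset ℕ) (m n : ℕ) (hn : n ≠ 0) (h : m ∣ n)
    (ht : ∀ q ∈ t, q.Prime) :
    ∏ q ∈ t, q ^ (m.factorization q) ≤ ∏ q ∈ t, q ^ (n.factorization q) := by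
  apply Finset.prod_le_prod'
  intro q hq
  exact Nat.pow_le_pow_right (ht q hq).pos
    ((Nat.factorization_le_iff_dvd (ne_zero_of_dvd_ne_zero hn h) hn).2 h q)

theorem kPi_insert_le {G : Type*} [Group G] [Finite G] (p : ℕ) (hp : p.Prime)
    (t : Finset ℕ) (ht : ∀ q ∈ t, q.Prime) (P : Sylow p G)
    (ih : ∀ H : Subgroup G, kPi (t : Set ℕ) H ≤ ∏ q ∈ t, q ^ ((Nat.card H).factorization q)) :
    kPi (insert p (t : Set ℕ)) G ≤
      Nat.card (ConjClasses P) * ∏ q ∈ t, q ^ ((Nat.card G).factorization q) := by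
  have : Fact p.Prime := ⟨hp⟩
  let r : ConjClasses P → G := fun c => ((Quotient.out c : P) : G)
  let C : ConjClasses P → Subgroup G := fun c => Subgroup.centralizer {r c}
  let B : ConjClasses P → Type _ := fun c =>
    {d : ConjClasses (C c) | ∃ x : C c, ConjClasses.mk x = d ∧ IsPiElement (t : Set ℕ) x}
  let f : (Σ c : ConjClasses P, B c) → ConjClasses G := fun s =>
    ConjClasses.mk (r s.1 * ((Quotient.out s.2.1 : C s.1) : G))
  have : Finite (ConjClasses P) := Quotient.finite _
  have : ∀ c, Finite (ConjClasses (C c)) := fun c => Quotient.finite _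
  have : ∀ c, Finite (B c) := fun c => Subtype.finite
  have : Finite (ConjClasses G) := Quotient.finite _
  letI : Fintype (ConjClasses P) := Fintype.ofFinite _
  have hsub : {c : ConjClasses G | ∃ x : G, ConjClasses.mk x = c ∧
      IsPiElement (insert p (t : Set ℕ)) x} ⊆ Set.range f := by
    rintro _ ⟨g, rfl, hg⟩
    obtain ⟨x, y, rfl, hxy, ⟨a, hx⟩, hy, hpy⟩ := pi_decomp p hp g
    have hPx : IsPGroup p (Subgroup.zpowers x) := by
      rintro ⟨_, k, rfl⟩
      refine ⟨a, Subtype.ext ?_⟩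
      change (x ^ k) ^ (p ^ a) = 1
      rw [← zpow_natCast, ← zpow_mul, mul_comm, zpow_mul, zpow_natCast, hx, one_zpow]
    obtain ⟨Q, hQ⟩ := hPx.exists_le_sylow
    obtain ⟨h, hh⟩ := MulAction.exists_smul_eq G Q P
    have hxP : h * x * h⁻¹ ∈ P := by
      rw [← hh]
      exact Subgroup.mem_map.2 ⟨x, hQ (Subgroup.mem_zpowers x), rfl⟩
    let c : ConjClasses P := ConjClasses.mk ⟨h * x * h⁻¹, hxP⟩
    have hc : IsConj (⟨h * x * h⁻¹, hxP⟩ : P) (Quotient.out c) :=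
      ConjClasses.mk_eq_mk_iff_isConj.1 (Quotient.out_eq c).symm
    obtain ⟨w, hw⟩ := isConj_iff.1 hc
    have hw' : (w : G) * (h * x * h⁻¹) * (w : G)⁻¹ = r c := congrArg Subtype.val hw
    let y' : G := ((w : G) * h) * y * ((w : G) * h)⁻¹
    have hrc : r c = ((w : G) * h) * x * ((w : G) * h)⁻¹ := by rw [← hw']; group
    have hy' : y' ∈ C c := by
      rw [Subgroup.mem_centralizer_singleton_iff, hrc]
      have := hxy.eq
      simp only [y']
      have e1 : ∀ u a b : G, u * a * u⁻¹ * (u * b * u⁻¹) = u * (a * b) * u⁻¹ := by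
        intros; group
      rw [e1, e1, this]
    have hpi : IsPiElement (t : Set ℕ) (⟨y', hy'⟩ : C c) := by
      intro q hq hqd
      have ho : orderOf (⟨y', hy'⟩ : C c) = orderOf y := by
        rw [← Subgroup.orderOf_coe]
        exact (MulAut.conj ((w : G) * h)).orderOf_eq y
      rw [ho] at hqd
      rcases hg q hq (hqd.trans hy) with h1 | h1
      · exact absurd (h1 ▸ hqd) hpy
      · exact h1
    let d : ConjClasses (C c) := ConjClasses.mk ⟨y', hy'⟩
    have hd : IsConj (⟨y', hy'⟩ : C c) (Quotient.out d) :=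
      ConjClasses.mk_eq_mk_iff_isConj.1 (Quotient.out_eq d).symm
    obtain ⟨z, hz⟩ := isConj_iff.1 hd
    have hz' : (z : G) * y' * (z : G)⁻¹ = ((Quotient.out d : C c) : G) :=
      congrArg Subtype.val hz
    refine ⟨⟨c, ⟨d, ⟨_, rfl, hpi⟩⟩⟩, ?_⟩
    apply Eq.symm
    apply ConjClasses.mk_eq_mk_iff_isConj.2
    change IsConj (x * y) (r c * ((Quotient.out d : C c) : G))
    rw [isConj_iff]
    refine ⟨(z : G) * ((w : G) * h), ?_⟩
    have hzc : (z : G) * r c * (z : G)⁻¹ = r c := by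
      have := Subgroup.mem_centralizer_singleton_iff.1 z.2
      rw [this]; group
    rw [← hz', ← hzc, hrc]
    simp only [y']
    group
  calc kPi (insert p (t : Set ℕ)) G ≤ Nat.card (Set.range f) :=
        Nat.card_mono (Set.toFinite _) hsub
    _ ≤ Nat.card (Σ c : ConjClasses P, B c) := Finite.card_range_le f
    _ = ∑ c, Nat.card (B c) := Nat.card_sigma
    _ ≤ ∑ c : ConjClasses P, ∏ q ∈ t, q ^ ((Nat.card G).factorization q) := by
        apply Finset.sum_le_sum
        intro c _
        exact (ih (C c)).trans
          (prod_mono_dvd t _ _ Nat.card_pos.ne' (Subgroup.card_subgroup_dvd_card _) ht)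
    _ = _ := by rw [Finset.sum_const, smul_eq_mul, Finset.card_univ, Nat.card_eq_fintype_card (α := ConjClasses P)]

theorem card_conj_le (G : Type*) [Group G] [Finite G] : Nat.card (ConjClasses G) ≤ Nat.card G :=
  Nat.card_le_card_of_surjective ConjClasses.mk ConjClasses.mk_surjective

universe u

theorem kPi_le (t : Finset ℕ) : ∀ (_ : ∀ q ∈ t, q.Prime) (G : Type u) [Group G] [Finite G],
    kPi (t : Set ℕ) G ≤ ∏ q ∈ t, q ^ ((Nat.card G).factorization q) := by
  induction t using Finset.induction_on with
  | empty =>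
    intro _ G _ _
    rw [Finset.prod_empty]
    unfold kPi
    rw [Finite.card_le_one_iff_subsingleton]
    have key : ∀ x : G, IsPiElement ((∅ : Finset ℕ) : Set ℕ) x → x = 1 := by
      intro x hx
      by_contra h
      have h1 : orderOf x ≠ 1 := fun h' => h (orderOf_eq_one_iff.1 h')
      obtain ⟨q, hq, hqd⟩ := Nat.exists_prime_and_dvd h1
      simpa using hx q hq hqd
    constructor
    rintro ⟨_, x, rfl, hx⟩ ⟨_, y, rfl, hy⟩
    apply Subtype.ext
    exact congrArg ConjClasses.mk ((key x hx).trans (key y hy).symm)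
  | insert p t hpt ih =>
    intro ht G _ _
    have hp : p.Prime := ht p (Finset.mem_insert_self _ _)
    have ht' : ∀ q ∈ t, q.Prime := fun q hq => ht q (Finset.mem_insert_of_mem hq)
    have : Fact p.Prime := ⟨hp⟩
    let P : Sylow p G := default
    have := kPi_insert_le p hp t ht' P (fun H => ih ht' H)
    rw [Finset.coe_insert, Finset.prod_insert hpt]
    refine this.trans (Nat.mul_le_mul_right _ ?_)
    exact (card_conj_le P).trans P.card_eq_multiplicity.le

/-- For `p ∈ π` dividing `|G|` and `P` a Sylow `p`-subgroup of `G`,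
`d_π(G) ≤ d(P)`. -/
theorem dPi_le_d_sylow
    {G : Type*} [Group G] [Finite G] (π : Set ℕ)
    (hπ : ∀ q ∈ π, Nat.Prime q) (p : ℕ) (hp : p ∈ π)
    (hdvd : p ∣ Nat.card G) (P : Sylow p G) :
    dPi π G ≤ (Nat.card (ConjClasses P) : ℚ) / (Nat.card P : ℚ) := by
  have hpp := hπ p hp
  have : Fact p.Prime := ⟨hpp⟩
  let s : Finset ℕ := (Nat.card G).primeFactors.filter (· ∈ π)
  have hs : ∀ q ∈ s, q.Prime := fun q hq =>
    Nat.prime_of_mem_primeFactors (Finset.mem_filter.1 hq).1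
  have hps : p ∈ s :=
    Finset.mem_filter.2 ⟨Nat.mem_primeFactors.2 ⟨hpp, hdvd, Nat.card_pos.ne'⟩, hp⟩
  let t := s.erase p
  have hts : insert p t = s := Finset.insert_erase hps
  have ht : ∀ q ∈ t, q.Prime := fun q hq => hs q (Finset.mem_of_mem_erase hq)
  have h1 : kPi π G ≤ kPi (insert p (t : Set ℕ)) G := by
    apply kPi_mono
    intro x hx q hq hqd
    rw [← Finset.coe_insert, hts]
    exact Finset.mem_filter.2 ⟨Nat.mem_primeFactors.2
      ⟨hq, hqd.trans (orderOf_dvd_natCard x), Nat.card_pos.ne'⟩, hx q hq hqd⟩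
  have h2 := h1.trans (kPi_insert_le p hpp t ht P (fun H => kPi_le t ht H))
  have h3 : piPart π (Nat.card G) =
      Nat.card P * ∏ q ∈ t, q ^ ((Nat.card G).factorization q) := by
    rw [P.card_eq_multiplicity,
      Finset.mul_prod_erase s (fun q => q ^ ((Nat.card G).factorization q)) hps,
      Finset.prod_filter]
    rfl
  have hT : 0 < ∏ q ∈ t, q ^ ((Nat.card G).factorization q) :=
    Finset.prod_pos fun q hq => pow_pos (ht q hq).pos _
  have hP : 0 < Nat.card P := Nat.card_pos
  unfold dPi
  rw [h3, div_le_div_iff₀ (by exact_mod_cast Nat.mul_pos hP hT) (by exact_mod_cast hP)]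
  have h4 := Nat.mul_le_mul_right (Nat.card P) h2
  norm_cast
  calc _ ≤ _ := h4
    _ = _ := by ring
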